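/- Let n ∈ ℕ, let Φ : ℝ^n → ℝ be twice continuously differentiable and convex with a nonempty set of minimizers, and let α, β > 0. Let x : ℝ → ℝ^n be twice differentiable and satisfy, for all t ≥ 0, x''(t) + α·x'(t) + β·(D(∇Φ)(x(t)))(x'(t)) + ∇Φ(x(t)) = 0, and assume there exists R > 0 with ‖x(t)‖ ≤ R and ‖x'(t)‖ ≤ R for all t ≥ 0. Then there exists a minimizer x* of Φ such that x(t) → x* and x'(t) → 0 as t → ∞. -/

import Mathlib

open Filter MeasureTheory

theorem exists_tendsto_of_hasDerivAt_nonpos {f f' : ℝ → ℝ} {a m : ℝ}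
    (hf : ∀ t, a ≤ t → HasDerivAt f (f' t) t) (hf' : ∀ t, a ≤ t → f' t ≤ 0)
    (hm : ∀ t, a ≤ t → m ≤ f t) : ∃ l, Tendsto f atTop (nhds l) := by
  have hanti : AntitoneOn f (Set.Ici a) := by
    refine antitoneOn_of_hasDerivWithinAt_nonpos (f' := f') (convex_Ici a)
      (fun t ht => (hf t ht).continuousAt.continuousWithinAt) ?_ ?_
    · exact fun t ht => (hf t (interior_subset ht)).hasDerivWithinAt
    · exact fun t ht => hf' t (interior_subset ht)
  have hanti' : Antitone fun t => f (max t a) := fun s t hst =>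
    hanti (Set.mem_Ici.2 (le_max_right s a)) (Set.mem_Ici.2 (le_max_right t a))
      (max_le_max_right a hst)
  have hbdd : BddBelow (Set.range fun t => f (max t a)) :=
    ⟨m, by rintro _ ⟨t, rfl⟩; exact hm _ (le_max_right t a)⟩
  refine ⟨_, (tendsto_atTop_ciInf hanti' hbdd).congr' ?_⟩
  filter_upwards [eventually_ge_atTop a] with t ht
  rw [max_eq_left ht]

/-- Barbalat lemma. -/
theorem tendsto_zero_of_tendsto_of_uniformContinuousOn_deriv {f f' : ℝ → ℝ} {a l : ℝ}
    (hf : ∀ t, a ≤ t → HasDerivAt f (f' t) t) (hf' : UniformContinuousOn f' (Set.Ici a))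
    (hl : Tendsto f atTop (nhds l)) : Tendsto f' atTop (nhds 0) := by
  rw [Metric.tendsto_nhds]
  intro ε hε
  obtain ⟨δ, hδ, hδf⟩ := Metric.uniformContinuousOn_iff.1 hf' (ε / 2) (half_pos hε)
  have hslope : Tendsto (fun t => (f (t + δ / 2) - f t) / (δ / 2)) atTop (nhds 0) := by
    simpa using ((hl.comp (tendsto_atTop_add_const_right _ (δ / 2) tendsto_id)).sub hl).div_const
      (δ / 2)
  filter_upwards [Metric.tendsto_nhds.1 hslope (ε / 2) (half_pos hε), eventually_ge_atTop a]
    with t ht hat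
  obtain ⟨c, ⟨hc₁, hc₂⟩, hc⟩ := exists_hasDerivAt_eq_slope f f' (show t < t + δ / 2 by linarith)
    (fun s hs => (hf s (hat.trans hs.1)).continuousAt.continuousWithinAt)
    (fun s hs => hf s (hat.trans hs.1.le))
  rw [add_sub_cancel_left] at hc
  rw [← hc] at ht
  have htc := hδf t hat c (hat.trans hc₁.le) (by
    rw [Real.dist_eq, abs_lt]; constructor <;> linarith)
  linarith [dist_triangle (f' t) (f' c) 0]

theorem uniformContinuousOn_Ici_of_hasDerivAt_bound {E : Type*} [NormedAddCommGroup E]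
    [NormedSpace ℝ E] {f f' : ℝ → E} {a C : ℝ}
    (hf : ∀ t, a ≤ t → HasDerivAt f (f' t) t) (hC : ∀ t, a ≤ t → ‖f' t‖ ≤ C) :
    UniformContinuousOn f (Set.Ici a) := by
  refine (LipschitzOnWith.of_dist_le_mul (K := C.toNNReal) fun s hs t ht => ?_).uniformContinuousOn
  rw [dist_eq_norm, dist_eq_norm]
  exact (convex_Ici a).norm_image_sub_le_of_norm_hasDerivWithin_le
    (fun u hu => (hf u hu).hasDerivWithinAt)
    (fun u hu => (hC u hu).trans (Real.le_coe_toNNReal C)) ht hs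

section Gradient

variable {E : Type*} [NormedAddCommGroup E] [InnerProductSpace ℝ E] [CompleteSpace E]

theorem ContDiff.gradient_of_two {Φ : E → ℝ} (hΦ : ContDiff ℝ 2 Φ) :
    ContDiff ℝ 1 (gradient Φ) :=
  (InnerProductSpace.toDual ℝ E).symm.contDiff.comp
    (hΦ.fderiv_right (m := 1) (by norm_num [one_add_one_eq_two]))

theorem HasGradientAt.comp_hasDerivAt_inner {Φ : E → ℝ} {g v : E} {x : ℝ → E} {t : ℝ}
    (hΦ : HasGradientAt Φ g (x t)) (hx : HasDerivAt x v t) :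
    HasDerivAt (fun s => Φ (x s)) (inner ℝ g v) t :=
  (hΦ.hasFDerivAt.comp_hasDerivAt t hx).congr_deriv (by simp)

theorem ConvexOn.inner_gradient_le_sub {Φ : E → ℝ} (hΦ : ConvexOn ℝ Set.univ Φ) {g a : E}
    (hg : HasGradientAt Φ g a) (b : E) : inner ℝ g (b - a) ≤ Φ b - Φ a := by
  have hconv : ConvexOn ℝ Set.univ (Φ ∘ AffineMap.lineMap (k := ℝ) a b) := by
    simpa using hΦ.comp_affineMap (AffineMap.lineMap a b)
  have hd : HasDerivAt (Φ ∘ AffineMap.lineMap (k := ℝ) a b) (inner ℝ g (b - a)) 0 :=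
    HasGradientAt.comp_hasDerivAt_inner (by simpa using hg) AffineMap.hasDerivAt_lineMap
  simpa [slope] using
    hconv.le_slope_of_hasDerivAt (Set.mem_univ 0) (Set.mem_univ 1) zero_lt_one hd

end Gradient

theorem MapClusterPt.eq_of_tendsto {X ι : Type*} [TopologicalSpace X] [T2Space X]
    {l : Filter ι} {f : ι → X} {a b : X} (ha : MapClusterPt a l f) (hb : Tendsto f l (nhds b)) :
    a = b :=
  eq_of_nhds_neBot (ha.neBot.mono (inf_le_inf_left _ hb))

/-- Opial lemma for relatively compact trajectories. -/
theorem exists_tendsto_of_tendsto_dist {X : Type*} [PseudoMetricSpace X] {ι : Type*}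
    {l : Filter ι} [NeBot l] {x : ι → X} {K S : Set X} (hK : IsCompact K)
    (hxK : ∀ᶠ t in l, x t ∈ K) (hcluster : ∀ z, MapClusterPt z l x → z ∈ S)
    (hdist : ∀ z ∈ S, ∃ d, Tendsto (fun t => dist (x t) z) l (nhds d)) :
    ∃ z ∈ S, Tendsto x l (nhds z) := by
  obtain ⟨z, -, hz⟩ := hK.exists_mapClusterPt (le_principal_iff.2 hxK)
  obtain ⟨d, hd⟩ := hdist z (hcluster z hz)
  refine ⟨z, hcluster z hz, tendsto_iff_dist_tendsto_zero.2 ?_⟩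
  have h0 : MapClusterPt (dist z z) l (fun t => dist (x t) z) :=
    hz.tendsto_comp ((continuous_id.dist continuous_const).tendsto z)
  rw [dist_self] at h0
  rwa [h0.eq_of_tendsto hd]

theorem stmt_19 {n : ℕ} (Φ : EuclideanSpace ℝ (Fin n) → ℝ) (hΦ : ContDiff ℝ 2 Φ)
    (hconv : ConvexOn ℝ Set.univ Φ)
    (hmin : ∃ z, ∀ y, Φ z ≤ Φ y)
    (α β : ℝ) (hα : 0 < α) (hβ : 0 < β)
    (x x' x'' : ℝ → EuclideanSpace ℝ (Fin n))
    (hx : ∀ t : ℝ, HasDerivAt x (x' t) t)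
    (hx' : ∀ t : ℝ, HasDerivAt x' (x'' t) t)
    (heq : ∀ t : ℝ, 0 ≤ t →
      x'' t + α • x' t + β • (fderiv ℝ (gradient Φ) (x t)) (x' t) + gradient Φ (x t) = 0)
    (R : ℝ) (hR : 0 < R)
    (hxb : ∀ t : ℝ, 0 ≤ t → ‖x t‖ ≤ R)
    (hx'b : ∀ t : ℝ, 0 ≤ t → ‖x' t‖ ≤ R) :
    ∃ xstar : EuclideanSpace ℝ (Fin n), (∀ y, Φ xstar ≤ Φ y) ∧
      Tendsto x atTop (nhds xstar) ∧ Tendsto x' atTop (nhds 0) := by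
  have hgrad : ∀ a, HasGradientAt Φ (gradient Φ a) a := fun a =>
    (hΦ.differentiable two_ne_zero a).hasGradientAt
  have hG : ContDiff ℝ 1 (gradient Φ) := hΦ.gradient_of_two
  set g : ℝ → EuclideanSpace ℝ (Fin n) := fun t => gradient Φ (x t) with hgdef
  let g' : ℝ → EuclideanSpace ℝ (Fin n) := fun t => fderiv ℝ (gradient Φ) (x t) (x' t)
  have hg : ∀ t, HasDerivAt g (g' t) t := fun t =>
    (hG.differentiable one_ne_zero (x t)).hasFDerivAt.comp_hasDerivAt t (hx t)
  have hφ : ∀ t, HasDerivAt (fun s => Φ (x s)) (inner ℝ (g t) (x' t)) t := fun t =>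
    (hgrad (x t)).comp_hasDerivAt_inner (hx t)
  have hK := isCompact_closedBall (0 : EuclideanSpace ℝ (Fin n)) R
  have hxK : ∀ t, 0 ≤ t → x t ∈ Metric.closedBall (0 : EuclideanSpace ℝ (Fin n)) R :=
    fun t ht => by simpa using hxb t ht
  obtain ⟨A, hA⟩ := hK.exists_bound_of_continuousOn hΦ.continuous.continuousOn
  obtain ⟨B, hB⟩ := hK.exists_bound_of_continuousOn hG.continuous.continuousOn
  obtain ⟨C, hC⟩ := hK.exists_bound_of_continuousOn
    (hG.continuous_fderiv one_ne_zero).continuousOn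
  have hgb : ∀ t, 0 ≤ t → ‖g t‖ ≤ B := fun t ht => hB _ (hxK t ht)
  have hg'b : ∀ t, 0 ≤ t → ‖g' t‖ ≤ C * R := fun t ht =>
    ContinuousLinearMap.le_of_opNorm_le_of_le _ (hC _ (hxK t ht)) (hx'b t ht)
  have hB0 : 0 ≤ B := (norm_nonneg _).trans (hgb 0 le_rfl)
  have hx''eq : ∀ t, 0 ≤ t → x'' t = -(α • x' t + β • g' t + g t) := fun t ht =>
    eq_neg_of_add_eq_zero_left (by rw [← heq t ht]; abel)
  have hx''b : ∀ t, 0 ≤ t → ‖x'' t‖ ≤ α * R + β * (C * R) + B := fun t ht => by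
    rw [hx''eq t ht, norm_neg]
    refine norm_add₃_le.trans ?_
    rw [norm_smul, norm_smul, Real.norm_of_nonneg hα.le, Real.norm_of_nonneg hβ.le]
    gcongr
    exacts [hx'b t ht, hg'b t ht, hgb t ht]
  -- The Lyapunov function and its dissipation rate.
  set V : ℝ → ℝ := fun t => (α * β + 1) * Φ (x t) + ‖x' t + β • g t‖ ^ 2 / 2 with hVdef
  set q : ℝ → ℝ := fun t => -(α * ‖x' t‖ ^ 2 + β * ‖g t‖ ^ 2) with hqdef
  have hy : ∀ t, HasDerivAt (fun s => x' s + β • g s) (x'' t + β • g' t) t := fun t =>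
    (hx' t).add ((hg t).const_smul β)
  have hy' : ∀ t, 0 ≤ t → x'' t + β • g' t = -(α • x' t + g t) := fun t ht => by
    rw [hx''eq t ht]; abel
  have hV : ∀ t, 0 ≤ t → HasDerivAt V (q t) t := fun t ht => by
    refine (((hφ t).const_mul (α * β + 1)).add ((hy t).norm_sq.div_const 2)).congr_deriv ?_
    rw [hy' t ht]
    simp only [hqdef, inner_add_left, inner_add_right, inner_neg_right, real_inner_smul_left,
      real_inner_smul_right, real_inner_self_eq_norm_sq, real_inner_comm (x' t) (g t)]
    ring
  obtain ⟨z₀, hz₀⟩ := hmin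
  have hVlow : ∀ t, 0 ≤ t → (α * β + 1) * Φ z₀ ≤ V t := fun t _ => by
    have := mul_le_mul_of_nonneg_left (hz₀ (x t)) (show 0 ≤ α * β + 1 by positivity)
    have : 0 ≤ ‖x' t + β • g t‖ ^ 2 / 2 := by positivity
    simp only [hVdef]; linarith
  obtain ⟨v, hv⟩ := exists_tendsto_of_hasDerivAt_nonpos hV
    (fun t _ => neg_nonpos.2 (by positivity)) hVlow
  have hquc : UniformContinuousOn q (Set.Ici 0) := by
    refine uniformContinuousOn_Ici_of_hasDerivAt_bound
      (C := α * (2 * (R * (α * R + β * (C * R) + B))) + β * (2 * (B * (C * R))))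
      (fun t _ => (((hx' t).norm_sq.const_mul α).add ((hg t).norm_sq.const_mul β)).neg)
      fun t ht => ?_
    rw [norm_neg]
    refine (norm_add_le _ _).trans ?_
    simp only [norm_mul, Real.norm_of_nonneg hα.le, Real.norm_of_nonneg hβ.le, Real.norm_two]
    gcongr
    · exact (norm_inner_le_norm _ _).trans
        (mul_le_mul (hx'b t ht) (hx''b t ht) (norm_nonneg _) hR.le)
    · exact (norm_inner_le_norm _ _).trans
        (mul_le_mul (hgb t ht) (hg'b t ht) (norm_nonneg _) hB0)
  have hq := (tendsto_zero_of_tendsto_of_uniformContinuousOn_deriv hV hquc hv).neg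
  rw [neg_zero] at hq
  have hx'0 : Tendsto x' atTop (nhds 0) := by
    refine squeeze_zero_norm (fun t => Real.le_sqrt_of_sq_le (y := -q t / α) ?_) (by
      simpa using (hq.div_const α).sqrt)
    rw [le_div_iff₀ hα]
    have : 0 ≤ β * ‖g t‖ ^ 2 := by positivity
    simp only [hqdef]
    linarith
  have hg0 : Tendsto g atTop (nhds 0) := by
    refine squeeze_zero_norm (fun t => Real.le_sqrt_of_sq_le (y := -q t / β) ?_) (by
      simpa using (hq.div_const β).sqrt)
    rw [le_div_iff₀ hβ]
    have : 0 ≤ α * ‖x' t‖ ^ 2 := by positivity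
    simp only [hqdef]
    linarith
  have hy0 : Tendsto (fun t => x' t + β • g t) atTop (nhds 0) := by
    simpa using hx'0.add (hg0.const_smul β)
  have hΦlim : ∃ c, Tendsto (fun t => Φ (x t)) atTop (nhds c) := by
    refine ⟨_, ((hv.sub ((hy0.norm.pow 2).div_const 2)).div_const (α * β + 1)).congr fun t => ?_⟩
    have : α * β + 1 ≠ 0 := by positivity
    simp only [hVdef]
    field_simp
    ring
  obtain ⟨c, hc⟩ := hΦlim
  have hdist : ∀ z ∈ {z | ∀ y, Φ z ≤ Φ y}, ∃ d,
      Tendsto (fun t => dist (x t) z) atTop (nhds d) := by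
    intro z hz
    have hxz : ∀ t, HasDerivAt (fun s => x s - z) (x' t) t := fun t => (hx t).sub_const z
    have hxzb : ∀ t, 0 ≤ t → ‖x t - z‖ ≤ R + ‖z‖ := fun t ht =>
      (norm_sub_le _ _).trans (by gcongr; exact hxb t ht)
    set u : ℝ → ℝ := fun t => inner ℝ (x' t + β • g t) (x t - z)
    set W : ℝ → ℝ := fun t => u t + α / 2 * ‖x t - z‖ ^ 2 - β * Φ (x t) + V t / α with hWdef
    have hu0 : Tendsto u atTop (nhds 0) := by
      refine squeeze_zero_norm' (a := fun t => ‖x' t + β • g t‖ * (R + ‖z‖)) ?_ ?_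
      · filter_upwards [eventually_ge_atTop 0] with t ht
        exact (norm_inner_le_norm _ _).trans (by gcongr; exact hxzb t ht)
      · simpa using hy0.norm.mul_const (R + ‖z‖)
    have hW : ∀ t, 0 ≤ t → HasDerivAt W
        (-inner ℝ (g t) (x t - z) - β / α * ‖g t‖ ^ 2) t := fun t ht => by
      refine (((((hy t).inner ℝ (hxz t)).add ((hxz t).norm_sq.const_mul (α / 2))).sub
        ((hφ t).const_mul β)).add ((hV t ht).div_const α)).congr_deriv ?_
      rw [hy' t ht]
      simp only [hqdef, inner_add_left, inner_neg_left, real_inner_smul_left,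
        real_inner_self_eq_norm_sq, real_inner_comm (x' t) (x t - z)]
      field_simp
      ring
    have hW' : ∀ t, 0 ≤ t → -inner ℝ (g t) (x t - z) - β / α * ‖g t‖ ^ 2 ≤ 0 := fun t _ => by
      have h₁ := hconv.inner_gradient_le_sub (hgrad (x t)) z
      rw [← neg_sub, inner_neg_right] at h₁
      have h₂ : 0 ≤ β / α * ‖g t‖ ^ 2 := by positivity
      have h₃ := hz (x t)
      simp only [hgdef] at h₂ ⊢
      linarith
    have hWlow : ∀ t, 0 ≤ t →
        -((R + β * B) * (R + ‖z‖)) - β * A + (α * β + 1) * Φ z₀ / α ≤ W t := fun t ht => by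
      have h₁ : |u t| ≤ (R + β * B) * (R + ‖z‖) := by
        refine (abs_real_inner_le_norm _ _).trans ?_
        gcongr
        · refine (norm_add_le _ _).trans ?_
          rw [norm_smul, Real.norm_of_nonneg hβ.le]
          gcongr
          exacts [hx'b t ht, hgb t ht]
        · exact hxzb t ht
      have h₂ : β * Φ (x t) ≤ β * A := by
        gcongr; exact (le_abs_self _).trans (hA _ (hxK t ht))
      have h₃ : (α * β + 1) * Φ z₀ / α ≤ V t / α := by gcongr; exact hVlow t ht
      have h₄ : 0 ≤ α / 2 * ‖x t - z‖ ^ 2 := by positivity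
      simp only [hWdef]
      linarith [(abs_le.1 h₁).1]
    obtain ⟨w, hw⟩ := exists_tendsto_of_hasDerivAt_nonpos hW hW' hWlow
    refine ⟨_, (((((hw.sub hu0).add (hc.const_mul β)).sub (hv.div_const α)).div_const
      (α / 2)).sqrt).congr fun t => ?_⟩
    rw [dist_eq_norm, ← Real.sqrt_sq (norm_nonneg (x t - z))]
    congr 1
    simp only [hWdef]
    field_simp
    ring
  have hcluster : ∀ z, MapClusterPt z atTop x → z ∈ {z | ∀ y, Φ z ≤ Φ y} := by
    intro z hz y
    have hgz : gradient Φ z = 0 := (hz.tendsto_comp (hG.continuous.tendsto z)).eq_of_tendsto hg0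
    have := hconv.inner_gradient_le_sub (hgrad z) y
    rw [hgz, inner_zero_left] at this
    linarith
  obtain ⟨z, hz, hxz⟩ := exists_tendsto_of_tendsto_dist hK
    ((eventually_ge_atTop 0).mono hxK) hcluster hdist
  exact ⟨z, hz, hxz, hx'0⟩
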